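/- Let q be a prime power and let n, k, ℓ, k₀ be nonnegative integers with ℓ ≤ k ≤ 2n and k = 2k₀ + ℓ. Then the number |SHull[2n,k]_q^ℓ| of linear [2n,k]_q codes with ℓ-dimensional symplectic hull equals ( ∏_{i=1}^{ℓ} (q^{2n−2k₀−2i+2} − 1)/(q^{2k₀+i} − q^{2k₀}) ) · q^{2k₀(n−k₀)} · [n choose k₀]_{q²}, where [n choose k₀]_{q²} = ∏_{i=0}^{k₀−1} (q^{2(n−i)} − 1)/(q^{2(k₀−i)} − 1). -/

import Mathlib

open scoped BigOperators
open Matrix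

noncomputable section

/-- The symplectic inner product `⟨x,y⟩_s = ∑_{i=1}^n (x_i y_{n+i} - x_{n+i} y_i)` on `K^{2n}`. -/
def sympInner {K : Type*} [Field K] (n : ℕ) (x y : Fin (2 * n) → K) : K :=
  ∑ i : Fin n,
    (x ⟨i.1, by have := i.2; omega⟩ * y ⟨n + i.1, by have := i.2; omega⟩ -
      x ⟨n + i.1, by have := i.2; omega⟩ * y ⟨i.1, by have := i.2; omega⟩)

/-- The symplectic dual `C^{⊥s}` of a code `C ⊆ K^{2n}`. -/
def sympDual {K : Type*} [Field K] (n : ℕ) (C : Submodule K (Fin (2 * n) → K)) :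
    Submodule K (Fin (2 * n) → K) where
  carrier := {y | ∀ x ∈ C, sympInner n x y = 0}
  zero_mem' := by
    intro x hx
    simp [sympInner]
  add_mem' := by
    intro y z hy hz x hx
    have h1 := hy x hx
    have h2 := hz x hx
    simp only [sympInner, Pi.add_apply] at h1 h2 ⊢
    calc (∑ i : Fin n, _) = (∑ i : Fin n,
          (x ⟨i.1, by have := i.2; omega⟩ * y ⟨n + i.1, by have := i.2; omega⟩ -
            x ⟨n + i.1, by have := i.2; omega⟩ * y ⟨i.1, by have := i.2; omega⟩)) +
        ∑ i : Fin n,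
          (x ⟨i.1, by have := i.2; omega⟩ * z ⟨n + i.1, by have := i.2; omega⟩ -
            x ⟨n + i.1, by have := i.2; omega⟩ * z ⟨i.1, by have := i.2; omega⟩) := by
          rw [← Finset.sum_add_distrib]
          exact Finset.sum_congr rfl fun i _ => by ring
      _ = 0 := by rw [h1, h2, add_zero]
  smul_mem' := by
    intro c y hy x hx
    have h := hy x hx
    simp only [sympInner, Pi.smul_apply, smul_eq_mul] at h ⊢
    calc (∑ i : Fin n, _) = c * ∑ i : Fin n,
          (x ⟨i.1, by have := i.2; omega⟩ * y ⟨n + i.1, by have := i.2; omega⟩ -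
            x ⟨n + i.1, by have := i.2; omega⟩ * y ⟨i.1, by have := i.2; omega⟩) := by
          rw [Finset.mul_sum]
          exact Finset.sum_congr rfl fun i _ => by ring
      _ = 0 := by rw [h, mul_zero]

/-- The matrix `Ω_n = [[O, I_n], [-I_n, O]]` defining the symplectic inner product. -/
def sympOmega (n : ℕ) (K : Type*) [Field K] : Matrix (Fin (2 * n)) (Fin (2 * n)) K :=
  Matrix.of fun i j => if j.1 = i.1 + n then 1 else if i.1 = j.1 + n then -1 else 0

/-- The block diagonal matrix `diag(J₂, …, J₂)` (with `J₂ = [[0,1],[-1,0]]`) of size `N`. -/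
def jayBlocks (N : ℕ) (K : Type*) [Field K] : Matrix (Fin N) (Fin N) K :=
  Matrix.of fun i j =>
    if i.1 % 2 = 0 ∧ j.1 = i.1 + 1 then 1
    else if j.1 % 2 = 0 ∧ i.1 = j.1 + 1 then -1 else 0


section Aux

open LinearMap Module

lemma aux_dc {α β : Type*} [Finite α] [Finite β] (S : α → Prop) (T : β → Prop)
    (R : α → β → Prop) (m c : ℚ)
    (h1 : ∀ a, S a → (Nat.card {b // T b ∧ R a b} : ℚ) = m)
    (h2 : ∀ b, T b → (Nat.card {a // S a ∧ R a b} : ℚ) = c) :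
    (Nat.card {a // S a} : ℚ) * m = Nat.card {b // T b} * c := by
  classical
  have := Fintype.ofFinite α
  have := Fintype.ofFinite β
  simp only [Nat.card_eq_fintype_card, Fintype.card_subtype] at *
  have key := Finset.sum_card_bipartiteAbove_eq_sum_card_bipartiteBelow R
    (s := Finset.univ.filter S) (t := Finset.univ.filter T)
  have key' := congrArg (Nat.cast : ℕ → ℚ) key
  push_cast at key'
  have e1 : ∀ a ∈ Finset.univ.filter S,
      ((Finset.bipartiteAbove R (Finset.univ.filter T) a).card : ℚ) = m := by
    intro a ha
    rw [← h1 a (by simpa using ha), Finset.bipartiteAbove, Finset.filter_filter]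
  have e2 : ∀ b ∈ Finset.univ.filter T,
      ((Finset.bipartiteBelow R (Finset.univ.filter S) b).card : ℚ) = c := by
    intro b hb
    rw [← h2 b (by simpa using hb), Finset.bipartiteBelow, Finset.filter_filter]
  rw [Finset.sum_congr rfl e1, Finset.sum_congr rfl e2] at key'
  simpa using key'

variable {K V : Type*} [Field K] [AddCommGroup V] [Module K V]

def auxHull (B : V →ₗ[K] V →ₗ[K] K) (C : Submodule K V) : Submodule K V where
  carrier := {y | y ∈ C ∧ ∀ x ∈ C, B x y = 0}
  zero_mem' := by simp
  add_mem' := by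
    rintro a b ⟨ha, ha'⟩ ⟨hb, hb'⟩
    exact ⟨C.add_mem ha hb, fun x hx => by simp [ha' x hx, hb' x hx]⟩
  smul_mem' := by
    rintro c a ⟨ha, ha'⟩
    exact ⟨C.smul_mem c ha, fun x hx => by simp [ha' x hx]⟩

lemma mem_auxHull {B : V →ₗ[K] V →ₗ[K] K} {C : Submodule K V} {y : V} :
    y ∈ auxHull B C ↔ y ∈ C ∧ ∀ x ∈ C, B x y = 0 := Iff.rfl

def auxW (B : V →ₗ[K] V →ₗ[K] K) (U : Submodule K V) (e f : V) : Submodule K V :=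
  U ⊓ (LinearMap.ker (B e) ⊓ LinearMap.ker (B f))

lemma mem_auxW {B : V →ₗ[K] V →ₗ[K] K} {U : Submodule K V} {e f y : V} :
    y ∈ auxW B U e f ↔ y ∈ U ∧ B e y = 0 ∧ B f y = 0 := Iff.rfl

lemma aux_swap {B : V →ₗ[K] V →ₗ[K] K} (hB : ∀ x, B x x = 0) (x y : V) :
    B x y = - B y x := by
  have h := hB (x + y)
  simp only [map_add, LinearMap.add_apply, hB, zero_add, add_zero] at h
  linear_combination h

lemma aux_exists {B : V →ₗ[K] V →ₗ[K] K} (hB : ∀ x, B x x = 0) {U : Submodule K V}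
    (hU : auxHull B U = ⊥) {e : V} (he : e ∈ U) (he0 : e ≠ 0) : ∃ f ∈ U, B e f = 1 := by
  by_contra! h
  apply he0
  have : e ∈ auxHull B U := by
    refine ⟨he, fun x hx => ?_⟩
    by_contra h0
    have h1 : B e x ≠ 0 := by rw [aux_swap hB]; simpa using h0
    exact h ((B e x)⁻¹ • x) (U.smul_mem _ hx) (by simp [h1])
  rw [hU] at this
  simpa using this

lemma aux_decomp {B : V →ₗ[K] V →ₗ[K] K} (hB : ∀ x, B x x = 0) {U : Submodule K V}
    {e f : V} (he : e ∈ U) (hf : f ∈ U) (hef : B e f = 1) {x : V} (hx : x ∈ U) :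
    x + B f x • e - B e x • f ∈ auxW B U e f := by
  have hfe : B f e = -1 := by rw [aux_swap hB, hef]
  refine mem_auxW.2 ⟨U.sub_mem (U.add_mem hx (U.smul_mem _ he)) (U.smul_mem _ hf), ?_, ?_⟩
  · simp [hB, hef]
  · simp [hB, hfe]

lemma auxW_nondeg {B : V →ₗ[K] V →ₗ[K] K} (hB : ∀ x, B x x = 0) {U : Submodule K V}
    (hU : auxHull B U = ⊥)
    {e f : V} (he : e ∈ U) (hf : f ∈ U) (hef : B e f = 1) :
    auxHull B (auxW B U e f) = ⊥ := by
  rw [eq_bot_iff]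
  rintro x ⟨⟨hxU, hx1, hx2⟩, hx3⟩
  rw [← hU]
  refine ⟨hxU, fun y hy => ?_⟩
  have h := hx3 _ (aux_decomp hB he hf hef hy)
  have hx1' : B e x = 0 := hx1
  have hx2' : B f x = 0 := hx2
  simpa [hx1', hx2'] using h

lemma aux_pair_disj {B : V →ₗ[K] V →ₗ[K] K} (hB : ∀ x, B x x = 0) {U D : Submodule K V}
    {e f : V} (hef : B e f = 1) (hD : D ≤ auxW B U e f) :
    Submodule.span K {e, f} ⊓ D = ⊥ := by
  have hfe : B f e = -1 := by rw [aux_swap hB, hef]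
  rw [eq_bot_iff]
  rintro x ⟨hx, hxD⟩
  obtain ⟨a, b, rfl⟩ := Submodule.mem_span_pair.1 hx
  obtain ⟨-, h1, h2⟩ := mem_auxW.1 (hD hxD)
  simp [hB, hef] at h1
  simp [hB, hfe] at h2
  simp [h1, h2]

lemma aux_pair_finrank {B : V →ₗ[K] V →ₗ[K] K} (hB : ∀ x, B x x = 0)
    {e f : V} (hef : B e f = 1) : finrank K (Submodule.span K {e, f}) = 2 := by
  have hfe : B f e = -1 := by rw [aux_swap hB, hef]
  have : LinearIndependent K ![e, f] := by
    rw [LinearIndependent.pair_iff]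
    intro a b h
    have h1 := congrArg (B e) h
    have h2 := congrArg (B f) h
    simp [hB, hef] at h1
    simp [hB, hfe] at h2
    exact ⟨h2, h1⟩
  have h := finrank_span_eq_card this
  have hr : Set.range ![e, f] = ({e, f} : Set V) := by
    ext x
    simp [eq_comm, or_comm]
  rw [hr, Fintype.card_fin] at h
  exact h

lemma aux_pair_sup {B : V →ₗ[K] V →ₗ[K] K} (hB : ∀ x, B x x = 0) {U C : Submodule K V}
    {e f : V} (he : e ∈ C) (hf : f ∈ C) (hef : B e f = 1) (hC : C ≤ U) :
    Submodule.span K {e, f} ⊔ (C ⊓ auxW B U e f) = C := by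
  apply le_antisymm
  · refine sup_le ?_ inf_le_left
    rw [Submodule.span_le]
    rintro x (rfl | rfl) <;> assumption
  · intro x hx
    have h := aux_decomp hB he hf hef hx
    rw [Submodule.mem_sup]
    refine ⟨(-B f x) • e + B e x • f, Submodule.mem_span_pair.2 ⟨_, _, rfl⟩, _,
      ⟨h.1, hC h.1, h.2⟩, ?_⟩
    module

lemma auxW_finrank [FiniteDimensional K V] {B : V →ₗ[K] V →ₗ[K] K} (hB : ∀ x, B x x = 0)
    {U : Submodule K V} {e f : V} (he : e ∈ U) (hf : f ∈ U) (hef : B e f = 1) :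
    finrank K (auxW B U e f) + 2 = finrank K U := by
  have h1 := aux_pair_sup hB he hf hef le_rfl
  have h2 := aux_pair_disj hB (U := U) hef le_rfl
  have h3 := Submodule.finrank_sup_add_finrank_inf_eq (Submodule.span K {e, f}) (auxW B U e f)
  have h4 : U ⊓ auxW B U e f = auxW B U e f := inf_eq_right.2 inf_le_left
  rw [h4] at h1
  rw [h1, h2, aux_pair_finrank hB hef, finrank_bot] at h3
  omega

lemma aux_pair_inf {B : V →ₗ[K] V →ₗ[K] K} (hB : ∀ x, B x x = 0) {U D : Submodule K V}
    {e f : V} (hef : B e f = 1) (hD : D ≤ auxW B U e f) :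
    (Submodule.span K {e, f} ⊔ D) ⊓ auxW B U e f = D := by
  rw [sup_comm, sup_inf_assoc_of_le _ hD, aux_pair_disj hB hef le_rfl, sup_bot_eq]

lemma aux_pair_hull {B : V →ₗ[K] V →ₗ[K] K} (hB : ∀ x, B x x = 0) {U D : Submodule K V}
    {e f : V} (hef : B e f = 1) (hD : D ≤ auxW B U e f) :
    auxHull B (Submodule.span K {e, f} ⊔ D) = auxHull B D := by
  have hfe : B f e = -1 := by rw [aux_swap hB, hef]
  ext x
  constructor
  · rintro ⟨hx, hx'⟩
    obtain ⟨p, hp, d, hd, rfl⟩ := Submodule.mem_sup.1 hx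
    obtain ⟨a, b, rfl⟩ := Submodule.mem_span_pair.1 hp
    obtain ⟨-, h1, h2⟩ := mem_auxW.1 (hD hd)
    have h3 := hx' e (Submodule.mem_sup_left (Submodule.subset_span (by simp)))
    have h4 := hx' f (Submodule.mem_sup_left (Submodule.subset_span (by simp)))
    simp [hB, hef, h1] at h3
    simp [hB, hfe, h2] at h4
    subst h3 h4
    simp only [zero_smul, zero_add] at hx' ⊢
    exact ⟨hd, fun y hy => hx' y (Submodule.mem_sup_right hy)⟩
  · rintro ⟨hx, hx'⟩
    refine ⟨Submodule.mem_sup_right hx, fun y hy => ?_⟩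
    obtain ⟨p, hp, d, hd, rfl⟩ := Submodule.mem_sup.1 hy
    obtain ⟨a, b, rfl⟩ := Submodule.mem_span_pair.1 hp
    obtain ⟨-, h1, h2⟩ := mem_auxW.1 (hD hx)
    simp [h1, h2, hx' d hd]

lemma aux_one_disj {B : V →ₗ[K] V →ₗ[K] K} (hB : ∀ x, B x x = 0) {U D : Submodule K V}
    {e f : V} (hef : B e f = 1) (hD : D ≤ auxW B U e f) :
    Submodule.span K {e} ⊓ D = ⊥ := by
  rw [eq_bot_iff, ← aux_pair_disj hB hef hD]
  exact inf_le_inf_right _ (Submodule.span_mono (by simp))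

lemma aux_one_inf {B : V →ₗ[K] V →ₗ[K] K} (hB : ∀ x, B x x = 0) {U D : Submodule K V}
    {e f : V} (hef : B e f = 1) (hD : D ≤ auxW B U e f) :
    (Submodule.span K {e} ⊔ D) ⊓ auxW B U e f = D := by
  rw [sup_comm, sup_inf_assoc_of_le _ hD, aux_one_disj hB hef le_rfl, sup_bot_eq]

lemma aux_one_hull {B : V →ₗ[K] V →ₗ[K] K} (hB : ∀ x, B x x = 0) {U D : Submodule K V}
    {e f : V} (hD : D ≤ auxW B U e f) :
    auxHull B (Submodule.span K {e} ⊔ D) = Submodule.span K {e} ⊔ auxHull B D := by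
  ext x
  constructor
  · rintro ⟨hx, hx'⟩
    obtain ⟨p, hp, d, hd, rfl⟩ := Submodule.mem_sup.1 hx
    obtain ⟨a, rfl⟩ := Submodule.mem_span_singleton.1 hp
    refine Submodule.add_mem_sup hp ⟨hd, fun y hy => ?_⟩
    have h := hx' y (Submodule.mem_sup_right hy)
    have h1 : B y e = 0 := by rw [aux_swap hB, (mem_auxW.1 (hD hy)).2.1, neg_zero]
    simpa [h1] using h
  · intro hx
    obtain ⟨p, hp, d, ⟨hd, hd'⟩, rfl⟩ := Submodule.mem_sup.1 hx
    obtain ⟨a, rfl⟩ := Submodule.mem_span_singleton.1 hp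
    refine ⟨Submodule.add_mem_sup hp hd, fun y hy => ?_⟩
    obtain ⟨p, hp, d', hd2, rfl⟩ := Submodule.mem_sup.1 hy
    obtain ⟨b, rfl⟩ := Submodule.mem_span_singleton.1 hp
    have h1 : B d' e = 0 := by rw [aux_swap hB, (mem_auxW.1 (hD hd2)).2.1, neg_zero]
    simp [hB, h1, (mem_auxW.1 (hD hd)).2.1, hd' d' hd2]

lemma aux_one_sup {B : V →ₗ[K] V →ₗ[K] K} (hB : ∀ x, B x x = 0) {U C : Submodule K V}
    {e f : V} (he : e ∈ auxHull B C) (hf : f ∈ U) (hef : B e f = 1) (hC : C ≤ U) :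
    Submodule.span K {e} ⊔ (C ⊓ auxW B U e f) = C := by
  apply le_antisymm
  · refine sup_le ?_ inf_le_left
    rw [Submodule.span_le]
    rintro x rfl
    exact he.1
  · intro x hx
    have h := aux_decomp hB (hC he.1) hf hef (hC hx)
    have h0 : B e x = 0 := by rw [aux_swap hB, he.2 x hx, neg_zero]
    rw [h0, zero_smul, sub_zero] at h
    rw [Submodule.mem_sup]
    refine ⟨(-B f x) • e, Submodule.mem_span_singleton.2 ⟨_, rfl⟩, _,
      ⟨C.add_mem hx (C.smul_mem _ he.1), h⟩, ?_⟩
    module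

def auxP (B : V →ₗ[K] V →ₗ[K] K) (U : Submodule K V) (k l : ℕ) (C : Submodule K V) : Prop :=
  C ≤ U ∧ finrank K C = k ∧ finrank K (auxHull B C) = l

lemma aux_finrank_sup [FiniteDimensional K V] {A D : Submodule K V} (h : A ⊓ D = ⊥) :
    finrank K ↥(A ⊔ D) = finrank K A + finrank K D := by
  have h3 := Submodule.finrank_sup_add_finrank_inf_eq A D
  rw [h, finrank_bot] at h3
  omega

lemma aux_one_card [FiniteDimensional K V] {B : V →ₗ[K] V →ₗ[K] K} (hB : ∀ x, B x x = 0)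
    {U : Submodule K V} {e f : V} (he : e ∈ U) (hf : f ∈ U) (hef : B e f = 1) (k l : ℕ) :
    Nat.card {C // auxP B U (k + 1) (l + 1) C ∧ e ∈ auxHull B C} =
      Nat.card {D // auxP B (auxW B U e f) k l D} := by
  have he0 : e ≠ 0 := by rintro rfl; simp at hef
  have key : ∀ D ≤ auxW B U e f, finrank K ↥(Submodule.span K {e} ⊔ D) = finrank K D + 1 ∧
      finrank K (auxHull B (Submodule.span K {e} ⊔ D)) = finrank K (auxHull B D) + 1 := by
    intro D hD
    have hH : auxHull B D ≤ auxW B U e f := fun x hx => hD hx.1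
    rw [aux_one_hull hB hD, aux_finrank_sup (aux_one_disj hB hef hD),
      aux_finrank_sup (aux_one_disj hB hef hH), finrank_span_singleton he0]
    omega
  refine Nat.card_congr
    { toFun := fun C => ⟨C.1 ⊓ auxW B U e f, ?_⟩
      invFun := fun D => ⟨Submodule.span K {e} ⊔ D.1, ?_⟩
      left_inv := ?_
      right_inv := ?_ }
  · obtain ⟨C, ⟨h1, h2, h3⟩, h4⟩ := C
    have hs := aux_one_sup hB h4 hf hef h1
    have := key _ (inf_le_right : C ⊓ auxW B U e f ≤ _)
    rw [hs] at this
    exact ⟨inf_le_right, by dsimp only; omega, by dsimp only; omega⟩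
  · obtain ⟨D, h1, h2, h3⟩ := D
    have := key _ h1
    refine ⟨⟨sup_le ?_ (h1.trans inf_le_left), by dsimp only; omega, by dsimp only; omega⟩, ?_⟩
    · rw [Submodule.span_le]
      rintro x rfl
      exact he
    · rw [aux_one_hull hB h1]
      exact Submodule.mem_sup_left (Submodule.mem_span_singleton_self e)
  · rintro ⟨C, ⟨h1, h2, h3⟩, h4⟩
    exact Subtype.ext (aux_one_sup hB h4 hf hef h1)
  · rintro ⟨D, h1, h2, h3⟩
    exact Subtype.ext (aux_one_inf hB hef h1)

lemma aux_pair_card [FiniteDimensional K V] {B : V →ₗ[K] V →ₗ[K] K} (hB : ∀ x, B x x = 0)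
    {U : Submodule K V} {e f : V} (he : e ∈ U) (hf : f ∈ U) (hef : B e f = 1) (k l : ℕ) :
    Nat.card {C // auxP B U (k + 2) l C ∧ (e ∈ C ∧ f ∈ C)} =
      Nat.card {D // auxP B (auxW B U e f) k l D} := by
  have key : ∀ D ≤ auxW B U e f, finrank K ↥(Submodule.span K {e, f} ⊔ D) = finrank K D + 2 ∧
      finrank K (auxHull B (Submodule.span K {e, f} ⊔ D)) = finrank K (auxHull B D) := by
    intro D hD
    rw [aux_pair_hull hB hef hD, aux_finrank_sup (aux_pair_disj hB hef hD),
      aux_pair_finrank hB hef]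
    omega
  refine Nat.card_congr
    { toFun := fun C => ⟨C.1 ⊓ auxW B U e f, ?_⟩
      invFun := fun D => ⟨Submodule.span K {e, f} ⊔ D.1, ?_⟩
      left_inv := ?_
      right_inv := ?_ }
  · obtain ⟨C, ⟨h1, h2, h3⟩, h4, h5⟩ := C
    have hs := aux_pair_sup hB h4 h5 hef h1
    have := key _ (inf_le_right : C ⊓ auxW B U e f ≤ _)
    rw [hs] at this
    exact ⟨inf_le_right, by dsimp only; omega, by dsimp only; omega⟩
  · obtain ⟨D, h1, h2, h3⟩ := D
    have := key _ h1
    refine ⟨⟨sup_le ?_ (h1.trans inf_le_left), by dsimp only; omega, by dsimp only; omega⟩, ?_, ?_⟩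
    · rw [Submodule.span_le]
      rintro x (rfl | rfl) <;> assumption
    · exact Submodule.mem_sup_left (Submodule.subset_span (by simp))
    · exact Submodule.mem_sup_left (Submodule.subset_span (by simp))
  · rintro ⟨C, ⟨h1, h2, h3⟩, h4, h5⟩
    exact Subtype.ext (aux_pair_sup hB h4 h5 hef h1)
  · rintro ⟨D, h1, h2, h3⟩
    exact Subtype.ext (aux_pair_inf hB hef h1)

lemma aux_card_ne [Finite K] [FiniteDimensional K V] (H : Submodule K V) :
    (Nat.card {e // e ∈ H ∧ e ≠ 0} : ℚ) = (Nat.card K : ℚ) ^ finrank K H - 1 := by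
  classical
  have : Finite V := Module.finite_of_finite K
  have := Fintype.ofFinite V
  have h := Module.natCard_eq_pow_finrank (K := K) (V := H)
  have h2 : Nat.card H = Nat.card {e // e ∈ H ∧ e ≠ 0} + 1 := by
    change Nat.card {e // e ∈ H} = _
    simp only [Nat.card_eq_fintype_card, Fintype.card_subtype]
    rw [← Finset.card_erase_add_one (a := (0 : V)) (by simp)]
    congr 2
    ext x
    simp [and_comm]
  rw [h] at h2
  have h3 := congrArg (Nat.cast : ℕ → ℚ) h2
  push_cast at h3
  linarith

def auxT (B : V →ₗ[K] V →ₗ[K] K) (U : Submodule K V) (p : V × V) : Prop :=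
  p.1 ∈ U ∧ p.2 ∈ U ∧ B p.1 p.2 = 1

lemma aux_fibre [Finite K] [FiniteDimensional K V] {B : V →ₗ[K] V →ₗ[K] K}
    {U : Submodule K V} {e f : V} (hf : f ∈ U) (hef : B e f = 1) :
    Nat.card {x // x ∈ U ∧ B e x = 1} * Nat.card K = Nat.card K ^ finrank K U := by
  rw [← Module.natCard_eq_pow_finrank (K := K) (V := U), ← Nat.card_prod]
  refine Nat.card_congr
    { toFun := fun p => ⟨p.1.1 + (p.2 - 1) • f, U.add_mem p.1.2.1 (U.smul_mem _ hf)⟩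
      invFun := fun x => (⟨x.1 - (B e x.1 - 1) • f, U.sub_mem x.2 (U.smul_mem _ hf), by
        simp [hef]⟩, B e x.1)
      left_inv := ?_
      right_inv := ?_ }
  · rintro ⟨⟨x, hx, hx'⟩, a⟩
    simp [hx', hef]
  · rintro ⟨x, hx⟩
    simp

lemma aux_pairs [Finite K] [FiniteDimensional K V] {B : V →ₗ[K] V →ₗ[K] K}
    (hB : ∀ x, B x x = 0) {U : Submodule K V} (hU : auxHull B U = ⊥) :
    (Nat.card {p // auxT B U p} : ℚ) =
      ((Nat.card K : ℚ) ^ finrank K U - 1) * ((Nat.card K : ℚ) ^ finrank K U / Nat.card K) := by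
  have : Finite V := Module.finite_of_finite K
  have hK : (Nat.card K : ℚ) ≠ 0 := by exact_mod_cast Nat.card_pos.ne'
  have h := aux_dc (fun e : V => e ∈ U ∧ e ≠ 0) (auxT B U) (fun e p => p.1 = e)
    ((Nat.card K : ℚ) ^ finrank K U / Nat.card K) 1 ?_ ?_
  · rw [aux_card_ne, mul_one] at h
    exact h.symm
  · rintro e ⟨he, he0⟩
    obtain ⟨f, hf, hef⟩ := aux_exists hB hU he he0
    rw [eq_div_iff hK]
    have := aux_fibre hf hef
    rw [← Nat.cast_pow, ← this, Nat.cast_mul]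
    congr 2
    refine Nat.card_congr
      { toFun := fun p => ⟨p.1.2, p.2.1.2.1, by have := p.2.1.2.2; rwa [p.2.2] at this⟩
        invFun := fun x => ⟨(e, x.1), ⟨he, x.2.1, x.2.2⟩, rfl⟩
        left_inv := ?_
        right_inv := ?_ }
    · rintro ⟨⟨a, b⟩, h1, rfl⟩
      rfl
    · rintro ⟨x, hx⟩
      rfl
  · rintro ⟨a, b⟩ ⟨ha, hb, hab⟩
    have : Nat.card {e // (e ∈ U ∧ e ≠ 0) ∧ a = e} = 1 := by
      rw [Nat.card_eq_one_iff_unique]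
      refine ⟨⟨fun x y => Subtype.ext (x.2.2.symm.trans y.2.2)⟩, ⟨⟨a, ⟨ha, ?_⟩, rfl⟩⟩⟩
      rintro rfl
      simp at hab
    simp only [this, Nat.cast_one]

lemma aux_rec_one [Finite K] [FiniteDimensional K V] {B : V →ₗ[K] V →ₗ[K] K}
    (hB : ∀ x, B x x = 0) {U : Submodule K V} (hU : auxHull B U = ⊥) (k l : ℕ) (c : ℚ)
    (hc : ∀ W : Submodule K V, auxHull B W = ⊥ → finrank K W + 2 = finrank K U →
      (Nat.card {D // auxP B W k l D} : ℚ) = c) :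
    (Nat.card {C // auxP B U (k + 1) (l + 1) C} : ℚ) * ((Nat.card K : ℚ) ^ (l + 1) - 1) =
      ((Nat.card K : ℚ) ^ finrank K U - 1) * c := by
  have : Finite V := Module.finite_of_finite K
  rw [← aux_card_ne U]
  refine aux_dc (auxP B U (k + 1) (l + 1)) (fun e => e ∈ U ∧ e ≠ 0)
    (fun C e => e ∈ auxHull B C) _ _ ?_ ?_
  · rintro C ⟨h1, h2, h3⟩
    rw [← h3, ← aux_card_ne]
    congr 1
    refine Nat.card_congr (Equiv.subtypeEquivRight fun e => ?_)
    exact ⟨fun h => ⟨h.2, h.1.2⟩, fun h => ⟨⟨h1 h.1.1, h.2⟩, h.1⟩⟩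
  · rintro e ⟨he, he0⟩
    obtain ⟨f, hf, hef⟩ := aux_exists hB hU he he0
    rw [aux_one_card hB he hf hef]
    exact hc _ (auxW_nondeg hB hU he hf hef) (auxW_finrank hB he hf hef)

lemma aux_rec_pair [Finite K] [FiniteDimensional K V] {B : V →ₗ[K] V →ₗ[K] K}
    (hB : ∀ x, B x x = 0) {U : Submodule K V} (hU : auxHull B U = ⊥) (k : ℕ) (c : ℚ)
    (hc : ∀ W : Submodule K V, auxHull B W = ⊥ → finrank K W + 2 = finrank K U →
      (Nat.card {D // auxP B W k 0 D} : ℚ) = c) :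
    (Nat.card {C // auxP B U (k + 2) 0 C} : ℚ) *
      (((Nat.card K : ℚ) ^ (k + 2) - 1) * ((Nat.card K : ℚ) ^ (k + 2) / Nat.card K)) =
      (((Nat.card K : ℚ) ^ finrank K U - 1) * ((Nat.card K : ℚ) ^ finrank K U / Nat.card K))
        * c := by
  have : Finite V := Module.finite_of_finite K
  rw [← aux_pairs hB hU]
  refine aux_dc (auxP B U (k + 2) 0) (auxT B U)
    (fun C p => p.1 ∈ C ∧ p.2 ∈ C) _ _ ?_ ?_
  · rintro C ⟨h1, h2, h3⟩
    rw [← h2, ← aux_pairs hB (Submodule.finrank_eq_zero.1 h3)]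
    congr 1
    refine Nat.card_congr (Equiv.subtypeEquivRight fun p => ?_)
    exact ⟨fun h => ⟨h.2.1, h.2.2, h.1.2.2⟩, fun h => ⟨⟨h1 h.1, h1 h.2.1, h.2.2⟩, h.1, h.2.1⟩⟩
  · rintro ⟨e, f⟩ ⟨he, hf, hef⟩
    rw [aux_pair_card hB he hf hef]
    exact hc _ (auxW_nondeg hB hU he hf hef) (auxW_finrank hB he hf hef)

def auxF (q n k₀ l : ℕ) : ℚ :=
      (∏ i ∈ Finset.Icc 1 l,
          ((q : ℚ) ^ (2 * (n : ℤ) - 2 * (k₀ : ℤ) - 2 * (i : ℤ) + 2) - 1) /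
            ((q : ℚ) ^ (2 * k₀ + i) - (q : ℚ) ^ (2 * k₀))) *
        ((q : ℚ) ^ (2 * k₀ * (n - k₀)) *
          ∏ i ∈ Finset.range k₀,
            ((q : ℚ) ^ (2 * (n - i)) - 1) / ((q : ℚ) ^ (2 * (k₀ - i)) - 1))

lemma aux_pow_ne {q : ℕ} (hq : 1 < q) {m : ℕ} (hm : m ≠ 0) : (q : ℚ) ^ m - 1 ≠ 0 := by
  have : (1 : ℚ) < (q : ℚ) ^ m := one_lt_pow₀ (by exact_mod_cast hq) hm
  linarith

lemma auxF_pair {q : ℕ} (hq : 1 < q) (n k₀ : ℕ) (h : k₀ ≤ n) :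
    auxF q (n + 1) (k₀ + 1) 0 * (((q : ℚ) ^ (2 * k₀ + 2) - 1) * ((q : ℚ) ^ (2 * k₀ + 2) / q)) =
      (((q : ℚ) ^ (2 * (n + 1)) - 1) * ((q : ℚ) ^ (2 * (n + 1)) / q)) * auxF q n k₀ 0 := by
  obtain ⟨m, rfl⟩ := Nat.exists_eq_add_of_le h
  have hq0 : (q : ℚ) ≠ 0 := by positivity
  have h1 := aux_pow_ne hq (m := 2 * (k₀ + 1)) (by omega)
  unfold auxF
  rw [Finset.prod_range_succ']
  have e1 : k₀ + m + 1 - (k₀ + 1) = m := by omega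
  have e2 : k₀ + m - k₀ = m := by omega
  simp only [Nat.add_sub_add_right, e2, Nat.sub_zero]
  set P := ∏ i ∈ Finset.range k₀, ((q : ℚ) ^ (2 * (k₀ + m - i)) - 1) / ((q : ℚ) ^ (2 * (k₀ - i)) - 1)
  simp only [Finset.Icc_eq_empty_of_lt (show (0 : ℕ) < 1 by omega), Finset.prod_empty, one_mul]
  rw [show 2 * k₀ + 2 = 2 * (k₀ + 1) by ring]
  field_simp
  ring

lemma auxF_one {q : ℕ} (hq : 1 < q) (n k₀ l : ℕ) (h : k₀ ≤ n) :
    auxF q (n + 1) k₀ (l + 1) * ((q : ℚ) ^ (l + 1) - 1) =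
      ((q : ℚ) ^ (2 * (n + 1)) - 1) * auxF q n k₀ l := by
  obtain ⟨m, rfl⟩ := Nat.exists_eq_add_of_le h
  have hq0 : (q : ℚ) ≠ 0 := by positivity
  have h1 := aux_pow_ne hq (m := l + 1) (by omega)
  have hD1 : ∏ i ∈ Finset.range k₀, ((q : ℚ) ^ (2 * (k₀ - i)) - 1) ≠ 0 :=
    Finset.prod_ne_zero_iff.2 fun i hi => aux_pow_ne hq (by
      have := Finset.mem_range.1 hi; omega)
  have hD2 : ∏ i ∈ Finset.range l, ((q : ℚ) ^ (2 * k₀ + (1 + i)) - (q : ℚ) ^ (2 * k₀)) ≠ 0 :=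
    Finset.prod_ne_zero_iff.2 fun i hi => by
      rw [pow_add, ← mul_sub_one]
      exact mul_ne_zero (pow_ne_zero _ hq0) (aux_pow_ne hq (by omega))
  have hG : (∏ i ∈ Finset.range k₀, ((q : ℚ) ^ (2 * (k₀ + m + 1 - i)) - 1)) *
      ((q : ℚ) ^ (2 * (m + 1)) - 1) =
      (∏ i ∈ Finset.range k₀, ((q : ℚ) ^ (2 * (k₀ + m - i)) - 1)) *
      ((q : ℚ) ^ (2 * (k₀ + m + 1)) - 1) := by
    have := Finset.prod_range_succ (fun i => ((q : ℚ) ^ (2 * (k₀ + m + 1 - i)) - 1)) k₀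
    rw [Finset.prod_range_succ'] at this
    simp only [Nat.add_sub_add_right, Nat.sub_zero,
      show k₀ + m + 1 - k₀ = m + 1 by omega] at this
    exact this.symm
  have hN : ∏ i ∈ Finset.range (l + 1), ((q : ℚ) ^ (2 * ((k₀ + m + 1 : ℕ) : ℤ) - 2 * (k₀ : ℤ)
        - 2 * ((1 + i : ℕ) : ℤ) + 2) - 1) =
      (∏ i ∈ Finset.range l, ((q : ℚ) ^ (2 * ((k₀ + m : ℕ) : ℤ) - 2 * (k₀ : ℤ)
        - 2 * ((1 + i : ℕ) : ℤ) + 2) - 1)) * ((q : ℚ) ^ (2 * (m + 1)) - 1) := by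
    rw [Finset.prod_range_succ']
    congr 1
    · refine Finset.prod_congr rfl fun i _ => ?_
      congr 2
      push_cast
      ring
    · rw [← zpow_natCast]
      congr 2
      push_cast
      ring
  unfold auxF
  have hI : ∀ l, Finset.Icc 1 l = Finset.Ico 1 (l + 1) := fun l => by ext; simp
  simp only [hI, Finset.prod_Ico_eq_prod_range, Nat.add_sub_cancel, Finset.prod_div_distrib]
  rw [hN, Finset.prod_range_succ (fun i => (q : ℚ) ^ (2 * k₀ + (1 + i)) - (q : ℚ) ^ (2 * k₀))]
  rw [show k₀ + m + 1 - k₀ = m + 1 by omega, show k₀ + m - k₀ = m by omega]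
  have e3 : (q : ℚ) ^ (2 * k₀ + (1 + l)) - (q : ℚ) ^ (2 * k₀) =
      q ^ (2 * k₀) * (q ^ (l + 1) - 1) := by ring
  rw [e3]
  have e4 : (q : ℚ) ^ (2 * k₀ * (m + 1)) = q ^ (2 * k₀) * q ^ (2 * k₀ * m) := by ring
  rw [e4]
  have hq1 : (q : ℚ) ^ (2 * k₀) ≠ 0 := pow_ne_zero _ hq0
  generalize (q : ℚ) ^ (2 * k₀) = a at *
  generalize (q : ℚ) ^ (2 * k₀ * m) = b at *
  generalize (q : ℚ) ^ (l + 1) - 1 = c at *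
  generalize (q : ℚ) ^ (2 * (m + 1)) - 1 = d at *
  generalize (q : ℚ) ^ (2 * (k₀ + m + 1)) - 1 = g at *
  generalize ∏ i ∈ Finset.range k₀, ((q : ℚ) ^ (2 * (k₀ - i)) - 1) = D1 at *
  generalize ∏ i ∈ Finset.range l, ((q : ℚ) ^ (2 * k₀ + (1 + i)) - a) = D2 at *
  generalize ∏ i ∈ Finset.range k₀, ((q : ℚ) ^ (2 * (k₀ + m - i)) - 1) = G at *
  generalize ∏ i ∈ Finset.range k₀, ((q : ℚ) ^ (2 * (k₀ + m + 1 - i)) - 1) = G' at *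
  field_simp
  generalize ∏ x ∈ Finset.range l, ((q : ℚ) ^ (2 * ((k₀ + m : ℕ) : ℤ) - 2 * (k₀ : ℤ)
        - 2 * ((1 + x : ℕ) : ℤ) + 2) - 1) = X at *
  linear_combination X * b * hG

lemma aux_main [Finite K] [FiniteDimensional K V] {B : V →ₗ[K] V →ₗ[K] K}
    (hB : ∀ x, B x x = 0) (l : ℕ) : ∀ (n k₀ : ℕ) (U : Submodule K V), auxHull B U = ⊥ → k₀ ≤ n →
      finrank K U = 2 * n →
      (Nat.card {C // auxP B U (2 * k₀ + l) l C} : ℚ) = auxF (Nat.card K) n k₀ l := by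
  have hq : 1 < Nat.card K := Finite.one_lt_card
  have hq0 : (Nat.card K : ℚ) ≠ 0 := by positivity
  induction l with
  | zero =>
    intro n k₀
    induction k₀ generalizing n with
    | zero =>
      intro U hU _ hn
      have : Nat.card {C // auxP B U (2 * 0 + 0) 0 C} = 1 := by
        rw [Nat.card_eq_one_iff_unique]
        refine ⟨⟨fun x y => Subtype.ext ?_⟩, ⟨⟨⊥, bot_le, by simp, ?_⟩⟩⟩
        · rw [Submodule.finrank_eq_zero.1 x.2.2.1, Submodule.finrank_eq_zero.1 y.2.2.1]
        · rw [Submodule.finrank_eq_zero, eq_bot_iff]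
          exact fun x hx => hx.1
      rw [this]
      simp [auxF]
    | succ k₀ ih =>
      intro U hU hk hn
      obtain ⟨n, rfl⟩ : ∃ m, n = m + 1 := ⟨n - 1, by omega⟩
      have h := aux_rec_pair hB hU (2 * k₀) (auxF (Nat.card K) n k₀ 0)
        (fun W hW hd => ih n W hW (by omega) (by omega))
      rw [hn, ← auxF_pair hq n k₀ (by omega)] at h
      exact mul_right_cancel₀ (mul_ne_zero (aux_pow_ne hq (by omega))
        (div_ne_zero (pow_ne_zero _ hq0) hq0)) h
  | succ l ih =>
    intro n k₀ U hU hk hn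
    rcases hk.eq_or_lt with rfl | hk
    · have : IsEmpty {C // auxP B U (2 * k₀ + (l + 1)) (l + 1) C} := by
        refine ⟨fun C => ?_⟩
        have h1 := Submodule.finrank_mono C.2.1
        have h2 := C.2.2.1
        omega
      rw [Nat.card_of_isEmpty]
      unfold auxF
      rw [Finset.prod_eq_zero (i := 1)]
      · simp
      · simp
      · simp
    · obtain ⟨n, rfl⟩ : ∃ m, n = m + 1 := ⟨n - 1, by omega⟩
      have h := aux_rec_one hB hU (2 * k₀ + l) l (auxF (Nat.card K) n k₀ l)
        (fun W hW hd => ih n k₀ W hW (by omega) (by omega))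
      rw [hn, ← auxF_one hq n k₀ l (by omega)] at h
      exact mul_right_cancel₀ (aux_pow_ne hq (by omega)) h

def auxB (K : Type*) [Field K] (n : ℕ) :
    (Fin (2 * n) → K) →ₗ[K] (Fin (2 * n) → K) →ₗ[K] K :=
  LinearMap.mk₂ K (sympInner n)
    (by intro x y z; simp only [sympInner, Pi.add_apply, ← Finset.sum_add_distrib]
        exact Finset.sum_congr rfl fun i _ => by ring)
    (by intro c x z; simp only [sympInner, Pi.smul_apply, smul_eq_mul, Finset.mul_sum]
        exact Finset.sum_congr rfl fun i _ => by ring)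
    (by intro x y z; simp only [sympInner, Pi.add_apply, ← Finset.sum_add_distrib]
        exact Finset.sum_congr rfl fun i _ => by ring)
    (by intro c x z; simp only [sympInner, Pi.smul_apply, smul_eq_mul, Finset.mul_sum]
        exact Finset.sum_congr rfl fun i _ => by ring)

lemma auxB_apply (n : ℕ) (x y : Fin (2 * n) → K) : auxB K n x y = sympInner n x y := rfl

lemma auxB_alt (n : ℕ) (x : Fin (2 * n) → K) : auxB K n x x = 0 := by
  rw [auxB_apply, sympInner]
  exact Finset.sum_eq_zero fun i _ => by ring

lemma auxB_nondeg (n : ℕ) : auxHull (auxB K n) ⊤ = ⊥ := by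
  rw [eq_bot_iff]
  rintro y ⟨-, hy⟩
  rw [Submodule.mem_bot]
  funext j
  by_cases hj : j.1 < n
  · have h := hy (Pi.single ⟨n + j.1, by omega⟩ 1) trivial
    rw [auxB_apply, sympInner, Finset.sum_eq_single ⟨j.1, hj⟩] at h
    · have hne : (⟨j.1, j.2⟩ : Fin (2 * n)) ≠ ⟨n + j.1, by omega⟩ := by
        intro h; rw [Fin.mk.injEq] at h; omega
      simpa [Pi.single_apply, hne, Fin.ext_iff, show n ≠ 0 by omega] using h
    · intro i _ hi
      have hi' : i.1 ≠ j.1 := fun h => hi (Fin.ext h)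
      have := i.2
      simp [Pi.single_apply, Fin.ext_iff, hi', show i.1 ≠ n + j.1 by omega]
    · simp
  · have h := hy (Pi.single ⟨j.1 - n, by omega⟩ 1) trivial
    have hj2 := j.2
    rw [auxB_apply, sympInner, Finset.sum_eq_single ⟨j.1 - n, by omega⟩] at h
    · have e : (⟨n + (j.1 - n), by omega⟩ : Fin (2 * n)) = j := Fin.ext (by simp; omega)
      simpa [Pi.single_apply, Fin.ext_iff, show n ≠ 0 by omega, e, show j.1 ≠ j.1 - n by omega] using h
    · intro i _ hi
      have hi' : i.1 ≠ j.1 - n := fun h => hi (Fin.ext h)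
      simp [Pi.single_apply, Fin.ext_iff, hi', show n + i.1 ≠ j.1 - n by omega]
    · simp

end Aux

/-- The mass formula for linear `[2n,k]_q` codes with `ℓ`-dimensional
symplectic hull, where `k = 2k₀ + ℓ`. -/
theorem card_symplectic_hull
    (q : ℕ) (hq : IsPrimePow q)
    {K : Type*} [Field K] [Fintype K] (hK : Fintype.card K = q)
    (n k ℓ k₀ : ℕ) (hℓk : ℓ ≤ k) (hkn : k ≤ 2 * n) (hk : k = 2 * k₀ + ℓ) :
    (Nat.card {C : Submodule K (Fin (2 * n) → K) //
        Module.finrank K C = k ∧ Module.finrank K ↥(C ⊓ sympDual n C) = ℓ} : ℚ) =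
      (∏ i ∈ Finset.Icc 1 ℓ,
          ((q : ℚ) ^ (2 * (n : ℤ) - 2 * (k₀ : ℤ) - 2 * (i : ℤ) + 2) - 1) /
            ((q : ℚ) ^ (2 * k₀ + i) - (q : ℚ) ^ (2 * k₀))) *
        ((q : ℚ) ^ (2 * k₀ * (n - k₀)) *
          ∏ i ∈ Finset.range k₀,
            ((q : ℚ) ^ (2 * (n - i)) - 1) / ((q : ℚ) ^ (2 * (k₀ - i)) - 1)) := by
  have hqc : Nat.card K = q := by rw [Nat.card_eq_fintype_card, hK]
  subst hk
  have h := aux_main (K := K) (auxB_alt n) ℓ n k₀ ⊤ (auxB_nondeg n) (by omega) (by simp)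
  rw [hqc] at h
  refine Eq.trans ?_ h
  congr 1
  refine Nat.card_congr (Equiv.subtypeEquivRight fun C => ?_)
  have e : C ⊓ sympDual n C = auxHull (auxB K n) C := rfl
  rw [e]
  simp [auxP]
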